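/- arXiv:1903.01055 — 2 statements merged into one kernel-verified Lean document; each statement's English description precedes it below -/
import Mathlib

section
/- (Existence and uniqueness for linear-quadratic problems.) For every integer N ≥ 2 and every pair of boundary data x* ∈ ℝ^{n_x}, λ* ∈ ℝ^{n_x}, there exists exactly one KKT trajectory (x_1,…,x_N, u_1,…,u_{N−1}, λ_1,…,λ_N) of the linear-quadratic problem P_{1:N}(x*, λ*). -/
open Matrix

/-- The controllability matrix `[b, Ab, …, A^{n_x−1}b]`. -/
def ctrbMat {nx : ℕ} (A : Matrix (Fin nx) (Fin nx) ℝ) (b : Fin nx → ℝ) :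
    Matrix (Fin nx) (Fin nx) ℝ :=
  Matrix.of fun i j => ((A ^ (j : ℕ)) *ᵥ b) i

/-- KKT trajectory of the linear-quadratic problem `P_{M:N}(xs, ls)`. -/
def LQKKT {nx : ℕ} (A Q : Matrix (Fin nx) (Fin nx) ℝ) (b f c : Fin nx → ℝ) (r : ℝ)
    (M N : ℤ) (xs ls : Fin nx → ℝ)
    (x : ℤ → Fin nx → ℝ) (u : ℤ → ℝ) (lam : ℤ → Fin nx → ℝ) : Prop :=
  x M = xs ∧ lam N = ls ∧
  (∀ i, M ≤ i → i < N → x (i+1) = A *ᵥ x i + u i • b + c) ∧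
  (∀ i, M ≤ i → i < N → lam i = (2:ℝ) • (Q *ᵥ x i) - f + Aᵀ *ᵥ lam (i+1)) ∧
  (∀ i, M ≤ i → i < N → 2 * r * u i + b ⬝ᵥ lam (i+1) = 0)

/-- One backward Riccati step: if the next adjoint is the affine function `P x + q` of the next
state, with `P` nonnegative as a quadratic form, then stationarity determines the input, and the
current adjoint is again such an affine function of the current state. -/
theorem exists_riccati_step {nx : ℕ} {Q : Matrix (Fin nx) (Fin nx) ℝ} (hQ : Q.PosSemidef)
    {r : ℝ} (hr : 0 < r) (A : Matrix (Fin nx) (Fin nx) ℝ) (b f c : Fin nx → ℝ)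
    (P : Matrix (Fin nx) (Fin nx) ℝ) (hP : ∀ x, 0 ≤ x ⬝ᵥ (P *ᵥ x)) (q : Fin nx → ℝ) :
    ∃ (P' : Matrix (Fin nx) (Fin nx) ℝ) (q' : Fin nx → ℝ) (v : (Fin nx → ℝ) → ℝ),
      (∀ x, 0 ≤ x ⬝ᵥ (P' *ᵥ x)) ∧
      (∀ x t, 2 * r * t + b ⬝ᵥ (P *ᵥ (A *ᵥ x + t • b + c) + q) = 0 ↔ t = v x) ∧
      ∀ x, P' *ᵥ x + q' =
        (2 : ℝ) • (Q *ᵥ x) - f + Aᵀ *ᵥ (P *ᵥ (A *ᵥ x + v x • b + c) + q) := by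
  have hd : 0 < 2 * r + b ⬝ᵥ (P *ᵥ b) := by linarith [hP b]
  set d := 2 * r + b ⬝ᵥ (P *ᵥ b) with hd_def
  set k : Fin nx → ℝ := -(d⁻¹ • (b ᵥ* (P * A))) with hk_def
  have hk : ∀ x, k ⬝ᵥ x = -(d⁻¹ * (b ⬝ᵥ (P *ᵥ (A *ᵥ x)))) := fun x => by
    rw [hk_def, neg_dotProduct, smul_dotProduct, ← dotProduct_mulVec, ← mulVec_mulVec,
      smul_eq_mul]
  set κ : ℝ := -(d⁻¹ * (b ⬝ᵥ (P *ᵥ c + q))) with hκ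
  have hP' : ∀ x, ((2 : ℝ) • Q + Aᵀ * P * (A + vecMulVec b k)) *ᵥ x =
      (2 : ℝ) • (Q *ᵥ x) + Aᵀ *ᵥ (P *ᵥ (A *ᵥ x + (k ⬝ᵥ x) • b)) := fun x => by
    simp only [add_mulVec, smul_mulVec, ← mulVec_mulVec, vecMulVec_mulVec, op_smul_eq_smul]
  refine ⟨(2 : ℝ) • Q + Aᵀ * P * (A + vecMulVec b k), -f + Aᵀ *ᵥ (P *ᵥ (κ • b + c) + q),
    fun x => k ⬝ᵥ x + κ, fun x => ?_, fun x t => ?_, fun x => ?_⟩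
  · have hx : 0 ≤ x ⬝ᵥ (Q *ᵥ x) := by simpa using hQ.dotProduct_mulVec_nonneg x
    have hy := hP (A *ᵥ x + (k ⬝ᵥ x) • b)
    have hb : b ⬝ᵥ (P *ᵥ (A *ᵥ x + (k ⬝ᵥ x) • b)) = -(2 * r * (k ⬝ᵥ x)) := by
      have h1 : d * (k ⬝ᵥ x) = -(b ⬝ᵥ (P *ᵥ (A *ᵥ x))) := by
        rw [hk]; field_simp
      simp only [mulVec_add, mulVec_smul, dotProduct_add, dotProduct_smul, smul_eq_mul]
      rw [hd_def] at h1
      linarith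
    rw [add_dotProduct, smul_dotProduct, hb, smul_eq_mul] at hy
    have hA : x ⬝ᵥ (Aᵀ *ᵥ (P *ᵥ (A *ᵥ x + (k ⬝ᵥ x) • b))) =
        (A *ᵥ x) ⬝ᵥ (P *ᵥ (A *ᵥ x + (k ⬝ᵥ x) • b)) := by
      rw [dotProduct_mulVec, vecMul_transpose]
    rw [hP', dotProduct_add, dotProduct_smul, hA, smul_eq_mul]
    nlinarith [mul_nonneg hr.le (sq_nonneg (k ⬝ᵥ x))]
  · have h : 2 * r * t + b ⬝ᵥ (P *ᵥ (A *ᵥ x + t • b + c) + q) =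
        d * (t - (k ⬝ᵥ x + κ)) := by
      have hopt : d * (k ⬝ᵥ x + κ) = -(b ⬝ᵥ (P *ᵥ (A *ᵥ x))) - b ⬝ᵥ (P *ᵥ c + q) := by
        rw [hk, hκ]; field_simp; ring
      rw [mul_sub, hopt, hd_def]
      simp only [mulVec_add, mulVec_smul, dotProduct_add, dotProduct_smul, smul_eq_mul]
      ring
    rw [h, mul_eq_zero, or_iff_right hd.ne', sub_eq_zero]
  · rw [hP']
    simp only [mulVec_add, mulVec_smul, add_smul]
    abel

/-- For every horizon length there is exactly one KKT trajectory, and its initial adjoint is an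
affine function of the initial state whose linear part is nonnegative as a quadratic form. -/
theorem exists_riccati_affine {nx : ℕ} {Q : Matrix (Fin nx) (Fin nx) ℝ} (hQ : Q.PosSemidef)
    {r : ℝ} (hr : 0 < r) (A : Matrix (Fin nx) (Fin nx) ℝ) (b f c : Fin nx → ℝ)
    (N : ℤ) (ls : Fin nx → ℝ) (n : ℕ) :
    ∃ (P : Matrix (Fin nx) (Fin nx) ℝ) (q : Fin nx → ℝ), (∀ x, 0 ≤ x ⬝ᵥ (P *ᵥ x)) ∧
      ∀ xs, ∃ (x : ℤ → Fin nx → ℝ) (u : ℤ → ℝ) (lam : ℤ → Fin nx → ℝ),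
        LQKKT A Q b f c r (N - n) N xs ls x u lam ∧ lam (N - n) = P *ᵥ xs + q ∧
        ∀ x' u' lam', LQKKT A Q b f c r (N - n) N xs ls x' u' lam' →
          (∀ i, N - n ≤ i → i ≤ N → x' i = x i ∧ lam' i = lam i) ∧
          ∀ i, N - n ≤ i → i < N → u' i = u i := by
  induction n with
  | zero =>
    refine ⟨0, ls, by simp, fun xs => ⟨fun _ => xs, 0, fun _ => ls, ?_, by simp, ?_⟩⟩
    · refine ⟨rfl, rfl, ?_, ?_, ?_⟩ <;> intro i h1 h2 <;> push_cast at h1 <;> omega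
    · rintro x' u' lam' ⟨hx, hl, -⟩
      refine ⟨fun i h1 h2 => ?_, fun i h1 h2 => ?_⟩
      · obtain rfl : i = N := by push_cast at h1; omega
        exact ⟨by simpa using hx, hl⟩
      · push_cast at h1; omega
  | succ n ih =>
    obtain ⟨P, q, hP, ih⟩ := ih
    obtain ⟨P', q', v, hP', hv, hstep⟩ := exists_riccati_step hQ hr A b f c P hP q
    refine ⟨P', q', hP', fun xs => ?_⟩
    obtain ⟨x, u, lam, ⟨hx, hl, hdyn, hadj, hstat⟩, hlam, huniq⟩ := ih (A *ᵥ xs + v xs • b + c)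
    obtain ⟨M, hM⟩ : ∃ M : ℤ, M = N - ((n + 1 : ℕ) : ℤ) := ⟨_, rfl⟩
    have hM1 : N - (n : ℤ) = M + 1 := by rw [hM]; push_cast; ring
    have hMN : M < N := by omega
    rw [← hM]
    rw [hM1] at hx hdyn hadj hstat hlam huniq ih
    have hv0 := (hv xs (v xs)).2 rfl
    refine ⟨fun i => if i = M then xs else x i, fun i => if i = M then v xs else u i,
      fun i => if i = M then P' *ᵥ xs + q' else lam i, ⟨by simp, by simp [hMN.ne', hl], ?_, ?_, ?_⟩,
      by simp, ?_⟩
    · intro i h1 h2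
      have : i + 1 ≠ M := by omega
      rcases eq_or_ne i M with rfl | h
      · simp [hx]
      · simpa [h, this] using hdyn i (by omega) h2
    · intro i h1 h2
      have : i + 1 ≠ M := by omega
      rcases eq_or_ne i M with rfl | h
      · simp [hlam, hstep]
      · simpa [h, this] using hadj i (by omega) h2
    · intro i h1 h2
      have : i + 1 ≠ M := by omega
      rcases eq_or_ne i M with rfl | h
      · simpa [hlam] using hv0
      · simpa [h, this] using hstat i (by omega) h2
    · rintro x' u' lam' ⟨hx', hl', hdyn', hadj', hstat'⟩
      have htail : LQKKT A Q b f c r (M + 1) N (x' (M + 1)) ls x' u' lam' :=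
        ⟨rfl, hl', fun i h => hdyn' i (by omega), fun i h => hadj' i (by omega),
          fun i h => hstat' i (by omega)⟩
      have hlam' : lam' (M + 1) = P *ᵥ x' (M + 1) + q := by
        obtain ⟨y, w, mu, -, hmu, hy⟩ := ih (x' (M + 1))
        rw [((hy x' u' lam' htail).1 (M + 1) le_rfl (by omega)).2, hmu]
      have hdynM := hdyn' M le_rfl hMN
      rw [hx'] at hdynM
      have huM : u' M = v xs := by
        rw [← hv, ← hdynM, ← hlam']
        exact hstat' M le_rfl hMN
      rw [huM] at hdynM
      have hlamM : lam' M = P' *ᵥ xs + q' := by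
        rw [hadj' M le_rfl hMN, hlam', hdynM, hx', hstep]
      rw [hdynM] at htail
      obtain ⟨hxl, hu⟩ := huniq x' u' lam' htail
      refine ⟨fun i h1 h2 => ?_, fun i h1 h2 => ?_⟩
      · rcases eq_or_ne i M with rfl | h
        · simp [hx', hlamM]
        · simpa [h] using hxl i (by omega) h2
      · rcases eq_or_ne i M with rfl | h
        · simp [huM]
        · simpa [h] using hu i (by omega) h2

/-- existence and uniqueness for linear-quadratic problems: for every
horizon `N ≥ 2` and all boundary data there is exactly one KKT trajectory of
`P_{1:N}(x*, λ*)` (uniqueness meaning agreement of the states and adjoints on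
`{1,…,N}` and of the inputs on `{1,…,N−1}`). -/
theorem lq_kkt_exists_unique
    (nx : ℕ) (hnx : 1 ≤ nx)
    (Q : Matrix (Fin nx) (Fin nx) ℝ) (hQ : Q.PosDef) (r : ℝ) (hr : 0 < r)
    (A : Matrix (Fin nx) (Fin nx) ℝ) (b : Fin nx → ℝ)
    (hctrb : IsUnit (ctrbMat A b)) (f c : Fin nx → ℝ) :
    ∀ N : ℤ, 2 ≤ N → ∀ xs ls : Fin nx → ℝ,
      (∃ (x : ℤ → Fin nx → ℝ) (u : ℤ → ℝ) (lam : ℤ → Fin nx → ℝ),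
        LQKKT A Q b f c r 1 N xs ls x u lam) ∧
      (∀ (x : ℤ → Fin nx → ℝ) (u : ℤ → ℝ) (lam : ℤ → Fin nx → ℝ)
         (x' : ℤ → Fin nx → ℝ) (u' : ℤ → ℝ) (lam' : ℤ → Fin nx → ℝ),
        LQKKT A Q b f c r 1 N xs ls x u lam →
        LQKKT A Q b f c r 1 N xs ls x' u' lam' →
        (∀ i : ℤ, 1 ≤ i → i ≤ N → x i = x' i ∧ lam i = lam' i) ∧
        (∀ i : ℤ, 1 ≤ i → i < N → u i = u' i)) := by
  intro N hN xs ls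
  obtain ⟨P, q, -, h⟩ := exists_riccati_affine hQ.posSemidef hr A b f c N ls (N - 1).toNat
  rw [Int.toNat_of_nonneg (by omega), sub_sub_cancel] at h
  obtain ⟨x, u, lam, hkkt, -, huniq⟩ := h xs
  refine ⟨⟨x, u, lam, hkkt⟩, fun x₁ u₁ lam₁ x₂ u₂ lam₂ h₁ h₂ => ?_⟩
  obtain ⟨hx₁, hu₁⟩ := huniq _ _ _ h₁
  obtain ⟨hx₂, hu₂⟩ := huniq _ _ _ h₂
  refine ⟨fun i hi hi' => ?_, fun i hi hi' => (hu₁ i hi hi').trans (hu₂ i hi hi').symm⟩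
  exact ⟨(hx₁ i hi hi').1.trans (hx₂ i hi hi').1.symm,
    (hx₁ i hi hi').2.trans (hx₂ i hi hi').2.symm⟩
end

section
/- (Convergence of the overlapping temporal decomposition scheme for linear-quadratic problems.) Let (x*, u*, λ*) be the unique KKT trajectory of P_{1:N}(x*_1, λ*_N). Let x^{(0)}_i, λ^{(0)}_i ∈ ℝ^{n_x} (i ∈ {1,…,N}) be any initial guess with x^{(0)}_1 = x*_1 and λ^{(0)}_N = λ*_N, and define iterates for t ≥ 0 by: for each k ∈ {1,…,K} and each i ∈ {M_k,…,N_k}, (x^{(t+1)}_i, λ^{(t+1)}_i) equals the (state, adjoint) value at index i of the unique KKT trajectory of the subproblem P_{M^ω_k:N^ω_k}(x^{(t)}_{M^ω_k}, λ^{(t)}_{N^ω_k}) (the linear-quadratic problem posed on the index set {M^ω_k,…,N^ω_k} with initial state x^{(t)}_{M^ω_k} and terminal cost gradient λ^{(t)}_{N^ω_k}). Then there exist constants C > 0 and ρ ∈ (0,1), depending only on n_x, A, b, Q, r, such that for all t ≥ 0: max_{i∈{1,…,N}} max(‖x^{(t)}_i − x*_i‖_∞, ‖λ^{(t)}_i −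 λ*_i‖_∞) ≤ (2 C ρ^ω)^t · max_{i∈{1,…,N}} max(‖x^{(0)}_i − x*_i‖_∞, ‖λ^{(0)}_i − λ*_i‖_∞). In particular, if ω is large enough that 2Cρ^ω < 1, the iterates converge to the trajectory of the full problem. -/
open Matrix Filter

theorem exists_norm_mulVec_le {nx : ℕ} (A : Matrix (Fin nx) (Fin nx) ℝ) :
    ∃ α : ℝ, 0 ≤ α ∧ ∀ v, ‖A *ᵥ v‖ ≤ α * ‖v‖ :=
  ⟨_, norm_nonneg _, fun v => (LinearMap.toContinuousLinearMap A.mulVecLin).le_opNorm v⟩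

theorem abs_dotProduct_le {nx : ℕ} (v w : Fin nx → ℝ) : |v ⬝ᵥ w| ≤ nx * (‖v‖ * ‖w‖) := by
  calc |v ⬝ᵥ w| ≤ ∑ i, |v i * w i| := Finset.abs_sum_le_sum_abs _ _
    _ ≤ ∑ _i : Fin nx, ‖v‖ * ‖w‖ := by
      refine Finset.sum_le_sum fun i _ => ?_
      rw [abs_mul]
      exact mul_le_mul (norm_le_pi_norm v i) (norm_le_pi_norm w i) (abs_nonneg _) (norm_nonneg _)
    _ = nx * (‖v‖ * ‖w‖) := by simp

theorem Matrix.PosDef.exists_mul_sq_norm_le {nx : ℕ} {Q : Matrix (Fin nx) (Fin nx) ℝ}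
    (hQ : Q.PosDef) : ∃ q : ℝ, 0 < q ∧ ∀ v, q * ‖v‖ ^ 2 ≤ v ⬝ᵥ Q *ᵥ v := by
  rcases isEmpty_or_nonempty (Fin nx) with h | h
  · exact ⟨1, one_pos, fun v => by simp [Subsingleton.elim v 0]⟩
  have hne : (Metric.sphere (0 : Fin nx → ℝ) 1).Nonempty :=
    NormedSpace.sphere_nonempty.mpr zero_le_one
  obtain ⟨w, hw, hmin⟩ := (isCompact_sphere (0 : Fin nx → ℝ) 1).exists_isMinOn hne
    (f := fun v => v ⬝ᵥ Q *ᵥ v) (by fun_prop)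
  have hw0 : w ≠ 0 := by
    rintro rfl
    simp at hw
  refine ⟨w ⬝ᵥ Q *ᵥ w, by simpa using hQ.dotProduct_mulVec_pos hw0, fun v => ?_⟩
  rcases eq_or_ne v 0 with rfl | hv
  · simp
  have hv' : 0 < ‖v‖ := norm_pos_iff.mpr hv
  have key : w ⬝ᵥ Q *ᵥ w ≤ (‖v‖⁻¹ • v) ⬝ᵥ Q *ᵥ (‖v‖⁻¹ • v) :=
    hmin (by simp [norm_smul, hv'.ne'])
  rw [mulVec_smul, dotProduct_smul, smul_dotProduct, smul_eq_mul, smul_eq_mul] at key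
  calc _ ≤ ‖v‖⁻¹ * (‖v‖⁻¹ * (v ⬝ᵥ Q *ᵥ v)) * ‖v‖ ^ 2 := by gcongr
    _ = _ := by field_simp

theorem exists_norm_le_of_isUnit_ctrbMat {nx : ℕ} {A : Matrix (Fin nx) (Fin nx) ℝ}
    {b : Fin nx → ℝ} (h : IsUnit (ctrbMat A b)) :
    ∃ κ : ℝ, 0 ≤ κ ∧ ∀ (v : Fin nx → ℝ) (B : ℝ), 0 ≤ B →
      (∀ j < nx, |(A ^ j *ᵥ b) ⬝ᵥ v| ≤ B) → ‖v‖ ≤ κ * B := by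
  obtain ⟨κ, hκ, hb⟩ := exists_norm_mulVec_le ((ctrbMat A b)ᵀ)⁻¹
  refine ⟨κ, hκ, fun v B hB hv => ?_⟩
  have hu : IsUnit (ctrbMat A b)ᵀ.det := by
    rw [det_transpose]
    exact (isUnit_iff_isUnit_det _).mp h
  have h1 := hb ((ctrbMat A b)ᵀ *ᵥ v)
  rw [mulVec_mulVec, nonsing_inv_mul _ hu, one_mulVec] at h1
  refine h1.trans (mul_le_mul_of_nonneg_left ?_ hκ)
  exact (pi_norm_le_iff_of_nonneg hB).mpr fun j => hv j j.2

/-- A trajectory on `{0, …, T}` of the KKT system with vanishing affine data. -/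
def IsHomKKT {nx : ℕ} (A Q : Matrix (Fin nx) (Fin nx) ℝ) (b : Fin nx → ℝ) (r : ℝ) (T : ℕ)
    (x : ℕ → Fin nx → ℝ) (u : ℕ → ℝ) (l : ℕ → Fin nx → ℝ) : Prop :=
  ∀ i < T, x (i + 1) = A *ᵥ x i + u i • b ∧
    l i = (2 : ℝ) • (Q *ᵥ x i) + Aᵀ *ᵥ l (i + 1) ∧ 2 * r * u i + b ⬝ᵥ l (i + 1) = 0

section HomKKT

variable {nx : ℕ} {A Q : Matrix (Fin nx) (Fin nx) ℝ} {b : Fin nx → ℝ} {r : ℝ}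

theorem IsHomKKT.dotProduct_sub {T : ℕ} {x : ℕ → Fin nx → ℝ} {u : ℕ → ℝ}
    {l : ℕ → Fin nx → ℝ} (h : IsHomKKT A Q b r T x u l) {i : ℕ} (hi : i < T) :
    x i ⬝ᵥ l i - x (i + 1) ⬝ᵥ l (i + 1) = 2 * (x i ⬝ᵥ Q *ᵥ x i) + 2 * r * u i ^ 2 := by
  obtain ⟨h1, h2, h3⟩ := h i hi
  have h4 : x i ⬝ᵥ Aᵀ *ᵥ l (i + 1) = (A *ᵥ x i) ⬝ᵥ l (i + 1) := by
    rw [dotProduct_mulVec, vecMul_transpose]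
  rw [h1, h2, dotProduct_add, add_dotProduct, h4, dotProduct_smul, smul_dotProduct,
    smul_eq_mul, smul_eq_mul]
  linear_combination (-(u i)) * h3

/-- Dissipation of the pairing `x ⬝ᵥ l` controls the states and the inputs. -/
theorem IsHomKKT.exists_dissipation (hQ : Q.PosDef) (hr : 0 < r) :
    ∃ g : ℝ, 0 < g ∧ ∀ (T : ℕ) (x : ℕ → Fin nx → ℝ) (u : ℕ → ℝ) (l : ℕ → Fin nx → ℝ),
      IsHomKKT A Q b r T x u l → ∀ i < T,
        g * ‖x i‖ ^ 2 ≤ x i ⬝ᵥ l i - x (i + 1) ⬝ᵥ l (i + 1) ∧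
        g * u i ^ 2 ≤ x i ⬝ᵥ l i - x (i + 1) ⬝ᵥ l (i + 1) := by
  obtain ⟨q, hq, hqv⟩ := hQ.exists_mul_sq_norm_le
  refine ⟨min q r, lt_min hq hr, fun T x u l h i hi => ?_⟩
  rw [h.dotProduct_sub hi]
  have h1 := hqv (x i)
  have h2 : min q r * ‖x i‖ ^ 2 ≤ q * ‖x i‖ ^ 2 := by gcongr; exact min_le_left _ _
  have h3 : min q r * u i ^ 2 ≤ r * u i ^ 2 := by gcongr; exact min_le_right _ _
  have h4 : 0 ≤ q * ‖x i‖ ^ 2 := by positivity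
  have h5 : 0 ≤ r * u i ^ 2 := by positivity
  constructor <;> linarith

theorem IsHomKKT.exists_abs_pow_dotProduct_le (hr : 0 < r) (j : ℕ) :
    ∃ c : ℝ, 0 ≤ c ∧ ∀ (T : ℕ) (x : ℕ → Fin nx → ℝ) (u : ℕ → ℝ) (l : ℕ → Fin nx → ℝ),
      IsHomKKT A Q b r T x u l → ∀ (p : ℕ) (δ : ℝ), p + j < T → 0 ≤ δ →
        (∀ i, p ≤ i → i ≤ p + j → ‖x i‖ ≤ δ ∧ |u i| ≤ δ) →
        |(A ^ j *ᵥ b) ⬝ᵥ l (p + j + 1)| ≤ c * δ := by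
  induction j with
  | zero =>
    refine ⟨2 * r, by positivity, fun T x u l h p δ hp hδ hb => ?_⟩
    have h3 := (h p hp).2.2
    have h4 := (hb p le_rfl le_rfl).2
    have h5 : (A ^ 0 *ᵥ b) ⬝ᵥ l (p + 0 + 1) = -(2 * r * u p) := by
      simp only [pow_zero, one_mulVec, add_zero]
      linarith
    rw [h5, abs_neg, abs_mul, abs_of_pos (by positivity : 0 < 2 * r)]
    gcongr
  | succ j ih =>
    obtain ⟨c, hc, ih⟩ := ih
    obtain ⟨α, hα, hQα⟩ := exists_norm_mulVec_le Q
    refine ⟨c + 2 * (nx * (‖A ^ j *ᵥ b‖ * α)), by positivity,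
      fun T x u l h p δ hp hδ hb => ?_⟩
    have h1 := ih T x u l h p δ (by omega) hδ fun i h1 h2 => hb i h1 (by omega)
    have h2 := (h (p + j + 1) (by omega)).2.1
    have h3 : (A ^ (j + 1) *ᵥ b) ⬝ᵥ l (p + (j + 1) + 1) =
        (A ^ j *ᵥ b) ⬝ᵥ l (p + j + 1) - 2 * ((A ^ j *ᵥ b) ⬝ᵥ Q *ᵥ x (p + j + 1)) := by
      have h4 : (A ^ (j + 1) *ᵥ b) ⬝ᵥ l (p + (j + 1) + 1) =
          (A ^ j *ᵥ b) ⬝ᵥ Aᵀ *ᵥ l (p + j + 1 + 1) := by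
        rw [dotProduct_mulVec, vecMul_transpose, mulVec_mulVec, ← pow_succ']
        rfl
      rw [h4, h2, dotProduct_add, dotProduct_smul, smul_eq_mul]
      ring
    have h5 : |(A ^ j *ᵥ b) ⬝ᵥ Q *ᵥ x (p + j + 1)| ≤ nx * (‖A ^ j *ᵥ b‖ * (α * δ)) := by
      refine (abs_dotProduct_le _ _).trans ?_
      have h6 := hQα (x (p + j + 1))
      have h7 := (hb (p + j + 1) (by omega) (by omega)).1
      gcongr
      exact h6.trans (by gcongr)
    rw [h3]
    refine (abs_sub _ _).trans ?_
    rw [abs_mul, abs_two]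
    linarith

theorem IsHomKKT.exists_norm_adjoint_le_of_terminal (k : ℕ) :
    ∃ c : ℝ, 0 ≤ c ∧ ∀ (T : ℕ) (x : ℕ → Fin nx → ℝ) (u : ℕ → ℝ) (l : ℕ → Fin nx → ℝ),
      IsHomKKT A Q b r T x u l → ∀ (p p' : ℕ) (δ : ℝ), p ≤ p' → p' ≤ p + k → p' ≤ T → 0 ≤ δ →
        (∀ i, p ≤ i → i < p' → ‖x i‖ ≤ δ) → ‖l p'‖ ≤ δ → ‖l p‖ ≤ c * δ := by
  induction k with
  | zero =>
    refine ⟨1, zero_le_one, fun T x u l h p p' δ hp hp' _ _ _ hl => ?_⟩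
    obtain rfl : p = p' := by omega
    simpa using hl
  | succ k ih =>
    obtain ⟨c, hc, ih⟩ := ih
    obtain ⟨α, hα, hQα⟩ := exists_norm_mulVec_le Q
    obtain ⟨β, hβ, hAβ⟩ := exists_norm_mulVec_le Aᵀ
    refine ⟨1 + 2 * α + β * c, by positivity, fun T x u l h p p' δ hp hp' hT hδ hx hl => ?_⟩
    rcases hp.eq_or_lt with rfl | hlt
    · have : 0 ≤ (2 * α + β * c) * δ := by positivity
      linarith
    · have h1 := ih T x u l h (p + 1) p' δ hlt (by omega) hT hδ
        (fun i h1 h2 => hx i (by omega) h2) hl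
      have h2 := hx p le_rfl hlt
      rw [(h p (by omega)).2.1]
      refine (norm_add_le _ _).trans ?_
      rw [norm_smul, Real.norm_two]
      have h3 : ‖Q *ᵥ x p‖ ≤ α * δ := (hQα _).trans (by gcongr)
      have h4 : ‖Aᵀ *ᵥ l (p + 1)‖ ≤ β * (c * δ) := (hAβ _).trans (by gcongr)
      linarith

/-- Controllability makes the adjoint observable from states and inputs on a window of length
`nx`. -/
theorem IsHomKKT.exists_norm_adjoint_le (hr : 0 < r) (hctrb : IsUnit (ctrbMat A b)) :
    ∃ c : ℝ, 0 ≤ c ∧ ∀ (T : ℕ) (x : ℕ → Fin nx → ℝ) (u : ℕ → ℝ) (l : ℕ → Fin nx → ℝ),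
      IsHomKKT A Q b r T x u l → ∀ (p : ℕ) (δ : ℝ), p + nx ≤ T → 0 ≤ δ →
        (∀ i, p ≤ i → i < p + nx → ‖x i‖ ≤ δ ∧ |u i| ≤ δ) → ‖l p‖ ≤ c * δ := by
  obtain ⟨κ, hκ, hobs⟩ := exists_norm_le_of_isUnit_ctrbMat hctrb
  choose d hd hdl using
    fun j => IsHomKKT.exists_abs_pow_dotProduct_le (A := A) (Q := Q) (b := b) hr j
  obtain ⟨c, hc, hback⟩ := IsHomKKT.exists_norm_adjoint_le_of_terminal (A := A) (Q := Q) (b := b)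
    (r := r) nx
  set D := ∑ j ∈ Finset.range nx, d j
  have hD0 : 0 ≤ D := Finset.sum_nonneg fun j _ => hd j
  refine ⟨c * (1 + κ * D), by positivity, fun T x u l h p δ hp hδ hb => ?_⟩
  have h1 : ‖l (p + nx)‖ ≤ κ * (D * δ) := by
    refine hobs _ _ (by positivity) fun j hj => ?_
    have h2 := hdl j T x u l h (p + nx - j - 1) δ (by omega) hδ
      fun i h1 h2 => hb i (by omega) (by omega)
    rw [show p + nx - j - 1 + j + 1 = p + nx by omega] at h2
    refine h2.trans ?_
    gcongr
    exact Finset.single_le_sum (fun i _ => hd i) (Finset.mem_range.mpr hj)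
  have h3 : 0 ≤ κ * (D * δ) := by positivity
  have h2 := hback T x u l h p (p + nx) ((1 + κ * D) * δ) (by omega) le_rfl hp (by positivity)
    (fun i h1 h2 => (hb i h1 h2).1.trans (by linarith)) (by linarith)
  linarith

end HomKKT

/-- A nonnegative antitone sequence that contracts over each window of length `m` decays
geometrically. -/
theorem geometric_decay_of_window {a : ℕ → ℝ} {T m : ℕ} {C ρ : ℝ} (hm : 1 ≤ m) (hC : 0 ≤ C)
    (hρ : 0 ≤ ρ) (hρ1 : ρ ≤ 1) (hCρ : C ≤ (1 + C) * ρ ^ m) (ha : ∀ i, 0 ≤ a i)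
    (hanti : ∀ i j, i ≤ j → j ≤ T → a j ≤ a i)
    (hstep : ∀ i, i + m ≤ T → (1 + C) * a (i + m) ≤ C * a i) :
    ∀ p ≤ T, ρ ^ m * a p ≤ ρ ^ p * a 0 := by
  intro p
  induction p using Nat.strong_induction_on with
  | _ p ih =>
    intro hp
    rcases lt_or_ge p m with h | h
    · exact mul_le_mul (pow_le_pow_of_le_one hρ hρ1 h.le) (hanti 0 p (Nat.zero_le _) hp) (ha _)
        (by positivity)
    · obtain ⟨q, rfl⟩ := Nat.exists_eq_add_of_le' h
      have h1 := ih q (by omega) (by omega)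
      have h2 := hstep q hp
      have h3 : (1 + C) * a (q + m) ≤ (1 + C) * (ρ ^ m * a q) := by
        refine h2.trans ?_
        rw [← mul_assoc]
        exact mul_le_mul_of_nonneg_right hCρ (ha q)
      have h4 : a (q + m) ≤ ρ ^ m * a q := le_of_mul_le_mul_left h3 (by linarith)
      calc ρ ^ m * a (q + m) ≤ ρ ^ m * (ρ ^ q * a 0) := by
            gcongr
            exact h4.trans h1
        _ = ρ ^ (q + m) * a 0 := by ring

theorem exists_rate {C : ℝ} (hC : 0 ≤ C) {m : ℕ} (hm : 1 ≤ m) :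
    ∃ ρ : ℝ, 0 < ρ ∧ ρ < 1 ∧ C ≤ (1 + C) * ρ ^ m := by
  have hm' : (1 : ℝ) ≤ m := by exact_mod_cast hm
  set y := 1 / (2 * (m * (1 + C))) with hy
  have hy0 : 0 < y := by positivity
  have hy1 : y ≤ 1 / 2 := by
    rw [hy, div_le_div_iff₀ (by positivity) two_pos]
    nlinarith
  refine ⟨1 - y, by linarith, by linarith, ?_⟩
  have h1 := mul_le_mul_of_nonneg_left (one_add_mul_le_pow (a := -y) (by linarith) m)
    (by linarith : 0 ≤ 1 + C)
  have h2 : (1 + C) * (1 + m * -y) = C + 1 / 2 := by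
    rw [hy]
    field_simp
    ring
  rw [h2] at h1
  rw [sub_eq_add_neg]
  linarith

theorem IsHomKKT.exists_sq_norm_le {nx : ℕ} {A Q : Matrix (Fin nx) (Fin nx) ℝ}
    {b : Fin nx → ℝ} {r : ℝ} (hQ : Q.PosDef) (hr : 0 < r) (hctrb : IsUnit (ctrbMat A b)) :
    ∃ c : ℝ, 0 ≤ c ∧ ∀ (T : ℕ) (x : ℕ → Fin nx → ℝ) (u : ℕ → ℝ) (l : ℕ → Fin nx → ℝ),
      IsHomKKT A Q b r T x u l → ∃ V : ℕ → ℝ, (∀ i, V i = x i ⬝ᵥ l i) ∧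
        (∀ i j, i ≤ j → j ≤ T → V j ≤ V i) ∧
        (∀ i < T, ‖x i‖ ^ 2 ≤ c * (V i - V (i + 1))) ∧
        (∀ i < T, ‖x (i + 1)‖ ^ 2 ≤ c * (V i - V (i + 1))) ∧
        (∀ p, p + nx ≤ T → ‖l p‖ ^ 2 ≤ c * (V p - V (p + nx))) ∧
        (∀ p ≤ T, T ≤ p + nx → ‖l p‖ ^ 2 ≤ c * (V p - V T + ‖l T‖ ^ 2)) := by
  obtain ⟨g, hg, hdiss⟩ := IsHomKKT.exists_dissipation (A := A) (b := b) hQ hr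
  obtain ⟨c₁, hc₁, hadj⟩ := IsHomKKT.exists_norm_adjoint_le (A := A) (Q := Q) (b := b) hr hctrb
  obtain ⟨c₂, hc₂, hterm⟩ := IsHomKKT.exists_norm_adjoint_le_of_terminal (A := A) (Q := Q) (b := b)
    (r := r) nx
  obtain ⟨α, hα, hA⟩ := exists_norm_mulVec_le A
  refine ⟨(1 + (α + ‖b‖) ^ 2 + c₁ ^ 2 + c₂ ^ 2) * (1 / g) + c₂ ^ 2, by positivity,
    fun T x u l h => ⟨fun i => x i ⬝ᵥ l i, fun _ => rfl, ?_⟩⟩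
  set c := (1 + (α + ‖b‖) ^ 2 + c₁ ^ 2 + c₂ ^ 2) * (1 / g) + c₂ ^ 2 with hc
  set V : ℕ → ℝ := fun i => x i ⬝ᵥ l i with hV
  have hd : ∀ i < T, g * ‖x i‖ ^ 2 ≤ V i - V (i + 1) ∧ g * u i ^ 2 ≤ V i - V (i + 1) :=
    hdiss T x u l h
  have hanti : ∀ i j, i ≤ j → j ≤ T → V j ≤ V i := by
    intro i j hij
    induction j, hij using Nat.le_induction with
    | base => exact fun _ => le_rfl
    | succ j _ ih =>
      intro hj
      have h1 := (hd j hj).1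
      have h2 : 0 ≤ g * ‖x j‖ ^ 2 := by positivity
      linarith [ih (by omega)]
  have hwin : ∀ p p', p ≤ p' → p' ≤ T → ∀ i, p ≤ i → i < p' →
      ‖x i‖ ≤ √((V p - V p') / g) ∧ |u i| ≤ √((V p - V p') / g) := by
    intro p p' hp hp' i hi hi'
    have h1 := hd i (by omega)
    have h2 := hanti p i hi (by omega)
    have h3 := hanti (i + 1) p' hi' hp'
    constructor
    · refine Real.le_sqrt_of_sq_le ((le_div_iff₀ hg).mpr ?_)
      linarith
    · refine Real.le_sqrt_of_sq_le ((le_div_iff₀ hg).mpr ?_)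
      rw [sq_abs]
      linarith
  have hnn : ∀ p p', p ≤ p' → p' ≤ T → 0 ≤ V p - V p' := fun p p' h1 h2 =>
    sub_nonneg.mpr (hanti p p' h1 h2)
  have hcle : ∀ (s D : ℝ), 0 ≤ D → s ^ 2 ≤ 1 + (α + ‖b‖) ^ 2 + c₁ ^ 2 + c₂ ^ 2 →
      s ^ 2 * (D / g) ≤ c * D := by
    intro s D hD hs
    have h1 : s ^ 2 * (D / g) ≤ (1 + (α + ‖b‖) ^ 2 + c₁ ^ 2 + c₂ ^ 2) * (D / g) := by gcongr
    have h2 : c * D = (1 + (α + ‖b‖) ^ 2 + c₁ ^ 2 + c₂ ^ 2) * (D / g) + c₂ ^ 2 * D := by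
      rw [hc]; ring
    have h3 : 0 ≤ c₂ ^ 2 * D := by positivity
    linarith
  have hsq : ∀ (y s D : ℝ), 0 ≤ y → 0 ≤ D → y ≤ s * √(D / g) →
      s ^ 2 ≤ 1 + (α + ‖b‖) ^ 2 + c₁ ^ 2 + c₂ ^ 2 → y ^ 2 ≤ c * D := by
    intro y s D hy hD hys hs
    calc y ^ 2 ≤ (s * √(D / g)) ^ 2 := by gcongr
      _ = s ^ 2 * (D / g) := by rw [mul_pow, Real.sq_sqrt (by positivity)]
      _ ≤ c * D := hcle s D hD hs
  refine ⟨hanti, fun i hi => ?_, fun i hi => ?_, fun p hp => ?_, fun p hp hp' => ?_⟩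
  · obtain ⟨h1, -⟩ := hwin i (i + 1) (by omega) hi i le_rfl (by omega)
    exact hsq _ 1 _ (norm_nonneg _) (hnn _ _ (by omega) hi) (by simpa using h1)
      (by nlinarith [sq_nonneg (α + ‖b‖)])
  · obtain ⟨h1, h2⟩ := hwin i (i + 1) (by omega) hi i le_rfl (by omega)
    refine hsq _ (α + ‖b‖) _ (norm_nonneg _) (hnn _ _ (by omega) hi) ?_
      (by nlinarith)
    rw [(h i hi).1]
    refine (norm_add_le _ _).trans ?_
    rw [norm_smul, Real.norm_eq_abs]
    have h3 := hA (x i)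
    have h4 := mul_le_mul_of_nonneg_left h1 hα
    have h5 := mul_le_mul_of_nonneg_right h2 (norm_nonneg b)
    linarith
  · exact hsq _ c₁ _ (norm_nonneg _) (hnn _ _ (by omega) hp)
      (hadj T x u l h p _ hp (Real.sqrt_nonneg _) (hwin p (p + nx) (by omega) hp))
      (by nlinarith [sq_nonneg (α + ‖b‖)])
  · have hD := hnn p T hp le_rfl
    have h1 := hterm T x u l h p T (√((V p - V T) / g + ‖l T‖ ^ 2)) hp hp' le_rfl
      (Real.sqrt_nonneg _)
      (fun i hi hi' => (hwin p T hp le_rfl i hi hi').1.trans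
        (Real.sqrt_le_sqrt (by simp)))
      (Real.le_sqrt_of_sq_le (by simpa using div_nonneg hD hg.le))
    have h2 : ‖l p‖ ^ 2 ≤ c₂ ^ 2 * ((V p - V T) / g + ‖l T‖ ^ 2) := by
      calc ‖l p‖ ^ 2 ≤ (c₂ * √((V p - V T) / g + ‖l T‖ ^ 2)) ^ 2 := by gcongr
        _ = _ := by rw [mul_pow, Real.sq_sqrt (by positivity)]
    have h3 := hcle c₂ _ hD (by nlinarith [sq_nonneg (α + ‖b‖)])
    have h4 : c₂ ^ 2 * ‖l T‖ ^ 2 ≤ c * ‖l T‖ ^ 2 := by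
      gcongr
      rw [hc]
      have : 0 ≤ (1 + (α + ‖b‖) ^ 2 + c₁ ^ 2 + c₂ ^ 2) * (1 / g) := by positivity
      linarith
    linarith

set_option maxHeartbeats 800000 in
/-- Exponential decay of the influence of the boundary data: data that vanish at a boundary point
or are at distance at least `w` contribute at most `C * ρ ^ w`. -/
theorem IsHomKKT.exists_exponential_decay {nx : ℕ} (hnx : 1 ≤ nx)
    {A Q : Matrix (Fin nx) (Fin nx) ℝ} {b : Fin nx → ℝ} {r : ℝ} (hQ : Q.PosDef) (hr : 0 < r)
    (hctrb : IsUnit (ctrbMat A b)) :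
    ∃ C : ℝ, 0 < C ∧ ∃ ρ : ℝ, 0 < ρ ∧ ρ < 1 ∧
      ∀ (T : ℕ) (x : ℕ → Fin nx → ℝ) (u : ℕ → ℝ) (l : ℕ → Fin nx → ℝ),
        IsHomKKT A Q b r T x u l → ∀ (ε : ℝ) (w p : ℕ), 1 ≤ T → p ≤ T → 0 ≤ ε →
          ‖x 0‖ ≤ ε → ‖l T‖ ≤ ε → (x 0 = 0 ∨ w ≤ p) → (l T = 0 ∨ p + w ≤ T) →
          ‖x p‖ ≤ C * ρ ^ w * ε ∧ ‖l p‖ ≤ C * ρ ^ w * ε := by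
  obtain ⟨c, hc, hsq⟩ := IsHomKKT.exists_sq_norm_le (A := A) (Q := Q) (b := b) hQ hr hctrb
  obtain ⟨ρ, hρ, hρ1, hCρ⟩ := exists_rate (C := nx * c) (by positivity) hnx
  set K : ℝ := 4 * nx ^ 2 * c + 1 with hK
  have hK0 : 0 ≤ K := by positivity
  set K' : ℝ := nx * (1 + c * (K + 1)) with hK'
  have hK'0 : 0 ≤ K' := by positivity
  set G : ℝ := (1 + c * (2 * K' + 1)) / ρ ^ (2 * nx) with hG
  have hG0 : 0 < G := by positivity
  refine ⟨√G, Real.sqrt_pos.mpr hG0, √ρ, Real.sqrt_pos.mpr hρ, ?_, ?_⟩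
  · rw [Real.sqrt_lt' one_pos]
    simpa using hρ1
  intro T x u l h ε w p hT hp hε hx0 hlT hxw hlw
  obtain ⟨V, hV, hanti, hx, hx', hl, hl'⟩ := hsq T x u l h
  have hdot : ∀ i, |V i| ≤ nx * (‖x i‖ * ‖l i‖) := fun i => hV i ▸ abs_dotProduct_le _ _
  have hx0' : ‖x 0‖ ^ 2 ≤ ε ^ 2 := by gcongr
  have hlT' : ‖l T‖ ^ 2 ≤ ε ^ 2 := by gcongr
  have hS0 : 0 ≤ V 0 - V T := sub_nonneg.mpr (hanti 0 T (by omega) le_rfl)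
  have hl0 : ‖l 0‖ ^ 2 ≤ c * (V 0 - V T + ε ^ 2) := by
    rcases le_total nx T with h1 | h1
    · refine (hl 0 (by omega)).trans ?_
      gcongr
      have := hanti (0 + nx) T (by omega) le_rfl
      linarith [sq_nonneg ε]
    · refine (hl' 0 (by omega) (by omega)).trans ?_
      gcongr
  have hxT : ‖x T‖ ^ 2 ≤ c * (V 0 - V T) := by
    obtain ⟨T', rfl⟩ := Nat.exists_eq_add_of_le' hT
    refine (hx' T' (by omega)).trans ?_
    gcongr
    exact hanti 0 T' (by omega) (by omega)
  have hV0 : V 0 ≤ nx * (ε * ‖l 0‖) := by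
    refine ((le_abs_self _).trans (hdot 0)).trans ?_
    gcongr
  have hVT : -V T ≤ nx * (ε * ‖x T‖) := by
    refine ((neg_le_abs _).trans (hdot T)).trans ?_
    rw [mul_comm ε]
    gcongr
  -- the total dissipation is controlled by the boundary data
  have hS : V 0 - V T ≤ K * ε ^ 2 := by
    have key : ∀ y : ℝ, 0 ≤ y → y ^ 2 ≤ c * (V 0 - V T + ε ^ 2) →
        nx * (ε * y) ≤ nx ^ 2 * c * ε ^ 2 + (V 0 - V T + ε ^ 2) / 4 := by
      intro y hy hy2
      rcases hc.eq_or_lt with h0 | h0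
      · rw [← h0, zero_mul] at hy2
        have : y = 0 := by nlinarith
        rw [this, ← h0]
        have := sq_nonneg ε
        simp
        linarith
      · have h1 : y ^ 2 / (4 * c) ≤ (V 0 - V T + ε ^ 2) / 4 := by
          rw [div_le_div_iff₀ (by positivity) (by positivity)]
          linarith
        have h2 : 0 ≤ (2 * c * nx * ε - y) ^ 2 / (4 * c) := by positivity
        have h3 : (2 * c * nx * ε - y) ^ 2 / (4 * c) =
            nx ^ 2 * c * ε ^ 2 - nx * (ε * y) + y ^ 2 / (4 * c) := by
          field_simp
          ring
        linarith
    have h1 := key _ (norm_nonneg _) hl0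
    have h2 := key _ (norm_nonneg _) (hxT.trans (by gcongr; linarith [sq_nonneg ε]))
    rw [hK]
    linarith
  have hbd : ∀ y : ℝ, 0 ≤ y → y ^ 2 ≤ c * (V 0 - V T + ε ^ 2) → nx * (ε * y) ≤ K' * ε ^ 2 := by
    intro y hy hy2
    have h1 : c * (V 0 - V T + ε ^ 2) ≤ c * (K * ε ^ 2 + ε ^ 2) := by gcongr
    have h2 : ε * y ≤ (1 + c * (K + 1)) * ε ^ 2 := by
      nlinarith [sq_nonneg (ε - y), mul_nonneg hε hy]
    rw [hK', mul_assoc]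
    gcongr
  have hV0' : V 0 ≤ K' * ε ^ 2 := hV0.trans (hbd _ (norm_nonneg _) hl0)
  have hVT' : -V T ≤ K' * ε ^ 2 :=
    hVT.trans (hbd _ (norm_nonneg _) (hxT.trans (by gcongr; linarith [sq_nonneg ε])))
  have hstep : ∀ q, q + nx ≤ T → |V q| ≤ nx * c * (V q - V (q + nx)) := by
    intro q hq
    refine (hdot q).trans ?_
    rw [mul_assoc]
    refine mul_le_mul_of_nonneg_left ?_ (Nat.cast_nonneg _)
    have h1 := hx q (by omega)
    have h2 := hl q hq
    have h3 : c * (V q - V (q + 1)) ≤ c * (V q - V (q + nx)) := by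
      gcongr
      exact hanti _ _ (by omega) hq
    nlinarith [sq_nonneg (‖x q‖ - ‖l q‖)]
  have hC0 : 0 ≤ nx * c := by positivity
  have hpos := geometric_decay_of_window (a := fun i => max (V i) 0) (T := T) hnx hC0 hρ.le hρ1.le
    hCρ (fun i => le_max_right _ _) (fun i j h1 h2 => max_le_max (hanti i j h1 h2) le_rfl) (by
      intro i hi
      have h1 := hstep i hi
      have h2 := hanti i (i + nx) (by omega) hi
      rcases le_total (V (i + nx)) 0 with h3 | h3
      · rw [max_eq_right h3]
        simpa using mul_nonneg hC0 (le_max_right (V i) 0)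
      · rw [max_eq_left h3, max_eq_left (h3.trans h2)]
        linarith [le_abs_self (V i)])
  have hneg := geometric_decay_of_window (a := fun i => max (-V (T - i)) 0) (T := T) hnx hC0 hρ.le
    hρ1.le hCρ (fun i => le_max_right _ _)
    (fun i j h1 h2 => max_le_max (neg_le_neg (hanti _ _ (by omega) (by omega))) le_rfl) (by
      intro i hi
      have h1 := hstep (T - (i + nx)) (by omega)
      have h2 := hanti (T - (i + nx)) (T - i) (by omega) (by omega)
      rw [show T - (i + nx) + nx = T - i by omega] at h1
      rcases le_total (-V (T - (i + nx))) 0 with h3 | h3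
      · rw [max_eq_right h3]
        simpa using mul_nonneg hC0 (le_max_right (-V (T - i)) 0)
      · rw [max_eq_left h3, max_eq_left (by linarith)]
        linarith [neg_abs_le (V (T - (i + nx)))])
  have hpw : ∀ {i j : ℕ}, i ≤ j → ρ ^ j ≤ ρ ^ i := fun hij =>
    pow_le_pow_of_le_one hρ.le hρ1.le hij
  have hB0 : 0 ≤ ρ ^ w * (K' * ε ^ 2) := by positivity
  have hVpos : ∀ q ≤ T, p ≤ q + 1 → ρ ^ (2 * nx) * V q ≤ ρ ^ w * (K' * ε ^ 2) := by
    intro q hq hqp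
    have h1 := hpos q hq
    have h2 : ρ ^ (2 * nx) * V q ≤ ρ ^ nx * (ρ ^ nx * max (V q) 0) := by
      rw [← mul_assoc, ← pow_add, ← two_mul]
      gcongr
      exact le_max_left _ _
    have h3 : ρ ^ nx * (ρ ^ nx * max (V q) 0) ≤ ρ ^ nx * (ρ ^ q * max (V 0) 0) := by gcongr
    refine (h2.trans h3).trans ?_
    rcases hxw with h0 | h0
    · have : V 0 = 0 := by rw [hV, h0, zero_dotProduct]
      simpa [this] using hB0
    · rw [← mul_assoc, ← pow_add]
      exact mul_le_mul (hpw (by omega)) (max_le hV0' (by positivity)) (le_max_right _ _)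
        (by positivity)
  have hVneg : ∀ q ≤ T, q ≤ p + nx → ρ ^ (2 * nx) * -V q ≤ ρ ^ w * (K' * ε ^ 2) := by
    intro q hq hqp
    have h1 := hneg (T - q) (by omega)
    simp only [Nat.sub_sub_self hq, Nat.sub_zero] at h1
    have h2 : ρ ^ (2 * nx) * -V q ≤ ρ ^ nx * (ρ ^ nx * max (-V q) 0) := by
      rw [← mul_assoc, ← pow_add, ← two_mul]
      gcongr
      exact le_max_left _ _
    have h3 : ρ ^ nx * (ρ ^ nx * max (-V q) 0) ≤ ρ ^ nx * (ρ ^ (T - q) * max (-V T) 0) := by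
      gcongr
    refine (h2.trans h3).trans ?_
    rcases hlw with h0 | h0
    · have : V T = 0 := by rw [hV, h0, dotProduct_zero]
      simpa [this] using hB0
    · rw [← mul_assoc, ← pow_add]
      exact mul_le_mul (hpw (by omega)) (max_le hVT' (by positivity)) (le_max_right _ _)
        (by positivity)
  have hfin : ∀ y : ℝ,
      ρ ^ (2 * nx) * y ^ 2 ≤ (1 + c * (2 * K' + 1)) * (ρ ^ w * ε ^ 2) → y ≤ √G * √ρ ^ w * ε := by
    intro y h1
    refine (abs_le_of_sq_le_sq' ?_ (by positivity)).2
    rw [mul_pow, mul_pow, ← pow_mul, mul_comm w 2, pow_mul, Real.sq_sqrt hG0.le,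
      Real.sq_sqrt hρ.le, hG, div_mul_eq_mul_div, div_mul_eq_mul_div, le_div_iff₀ (by positivity)]
    linarith
  have hE0 : 0 ≤ ρ ^ w * ε ^ 2 := by positivity
  have hle1 : ρ ^ (2 * nx) ≤ 1 := pow_le_one₀ hρ.le hρ1.le
  constructor
  · refine hfin _ ?_
    rcases Nat.eq_zero_or_pos p with rfl | hp0
    · have h1 : ‖x 0‖ ^ 2 ≤ ρ ^ w * ε ^ 2 := by
        rcases hxw with h0 | h0
        · simpa [h0] using hE0
        · obtain rfl : w = 0 := by omega
          simpa using hx0'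
      have h2 : ρ ^ (2 * nx) * ‖x 0‖ ^ 2 ≤ 1 * (ρ ^ w * ε ^ 2) := by gcongr
      have h3 : 0 ≤ c * (2 * K' + 1) * (ρ ^ w * ε ^ 2) := by positivity
      linarith
    · obtain ⟨q, rfl⟩ := Nat.exists_eq_add_of_le' hp0
      have h1 := hx' q hp
      have h2 := hVpos q (by omega) le_rfl
      have h3 := hVneg (q + 1) hp (by omega)
      have h4 : ρ ^ (2 * nx) * ‖x (q + 1)‖ ^ 2 ≤ ρ ^ (2 * nx) * (c * (V q - V (q + 1))) := by
        gcongr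
      have h5 := mul_le_mul_of_nonneg_left (add_le_add h2 h3) hc
      have h6 : 0 ≤ c * (ρ ^ w * ε ^ 2) := by positivity
      linarith
  · refine hfin _ ?_
    rcases le_total (p + nx) T with h0 | h0
    · have h1 := hl p h0
      have h2 := hVpos p hp (by omega)
      have h3 := hVneg (p + nx) h0 le_rfl
      have h4 : ρ ^ (2 * nx) * ‖l p‖ ^ 2 ≤ ρ ^ (2 * nx) * (c * (V p - V (p + nx))) := by gcongr
      have h5 := mul_le_mul_of_nonneg_left (add_le_add h2 h3) hc
      have h6 : 0 ≤ c * (ρ ^ w * ε ^ 2) := by positivity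
      linarith
    · have h1 := hl' p hp h0
      have h2 := hVpos p hp (by omega)
      have h3 := hVneg T le_rfl h0
      have h4 : ρ ^ (2 * nx) * ‖l p‖ ^ 2 ≤ ρ ^ (2 * nx) * (c * (V p - V T + ‖l T‖ ^ 2)) := by
        gcongr
      have h7 : ρ ^ (2 * nx) * ‖l T‖ ^ 2 ≤ ρ ^ w * ε ^ 2 := by
        rcases hlw with h8 | h8
        · simpa [h8] using hE0
        · exact mul_le_mul (hpw (by omega)) hlT' (by positivity) (by positivity)
      have h5 := mul_le_mul_of_nonneg_left (add_le_add (add_le_add h2 h3) h7) hc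
      linarith

/-- The difference of two KKT trajectories solves the homogeneous system. -/
theorem LQKKT.isHomKKT_sub {nx : ℕ} {A Q : Matrix (Fin nx) (Fin nx) ℝ} {b f c : Fin nx → ℝ}
    {r : ℝ} {M N M' N' : ℤ} {xs ls xs' ls' : Fin nx → ℝ} {x x' : ℤ → Fin nx → ℝ} {u u' : ℤ → ℝ}
    {l l' : ℤ → Fin nx → ℝ} (h : LQKKT A Q b f c r M N xs ls x u l)
    (h' : LQKKT A Q b f c r M' N' xs' ls' x' u' l') (hM : M' ≤ M) (hN : N ≤ N') {T : ℕ}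
    (hT : M + T = N) :
    IsHomKKT A Q b r T (fun i => x (M + i) - x' (M + i)) (fun i => u (M + i) - u' (M + i))
      (fun i => l (M + i) - l' (M + i)) := by
  obtain ⟨-, -, h1, h2, h3⟩ := h
  obtain ⟨-, -, h1', h2', h3'⟩ := h'
  intro i hi
  have hi1 : M ≤ M + (i : ℤ) := by omega
  have hi2 : M + (i : ℤ) < N := by omega
  have e : M + ((i + 1 : ℕ) : ℤ) = M + i + 1 := by push_cast; ring
  dsimp only
  rw [e]
  refine ⟨?_, ?_, ?_⟩
  · rw [h1 _ hi1 hi2, h1' _ (by omega) (by omega), mulVec_sub, sub_smul]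
    abel
  · rw [h2 _ hi1 hi2, h2' _ (by omega) (by omega), mulVec_sub, mulVec_sub, smul_sub]
    abel
  · have := h3 _ hi1 hi2
    have := h3' (M + i) (by omega) (by omega)
    rw [dotProduct_sub]
    linarith

theorem exists_mem_block {K : ℕ} {Mk Nk : ℕ → ℤ} (hK : 1 ≤ K)
    (hconsec : ∀ k, 1 ≤ k → k ≤ K - 1 → Mk (k + 1) = Nk k + 1) {i : ℤ} (hi : Mk 1 ≤ i)
    (hi' : i ≤ Nk K) : ∃ k, 1 ≤ k ∧ k ≤ K ∧ Mk k ≤ i ∧ i ≤ Nk k := by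
  have key : ∀ k, 1 ≤ k → k ≤ K → i ≤ Nk k → ∃ k, 1 ≤ k ∧ k ≤ K ∧ Mk k ≤ i ∧ i ≤ Nk k := by
    intro k hk
    induction k, hk using Nat.le_induction with
    | base => exact fun h1 h2 => ⟨1, le_rfl, h1, hi, h2⟩
    | succ k hk ih =>
      intro h1 h2
      rcases le_or_gt i (Nk k) with h3 | h3
      · exact ih (by omega) h3
      · exact ⟨k + 1, by omega, h1, by rw [hconsec k hk (by omega)]; omega, h2⟩
  exact key K hK le_rfl hi'

/-- convergence of the overlapping temporal decomposition scheme for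
linear-quadratic problems: there exist `C > 0` and `ρ ∈ (0,1)`, depending only on
`n_x, A, b, Q, r`, such that the overlapping-decomposition iterates contract toward the
trajectory of the full problem at the linear rate `2 C ρ^ω`; in particular, if
`2 C ρ^ω < 1` the iterates converge. -/
theorem lq_decomposition_convergence
    (nx : ℕ) (hnx : 1 ≤ nx)
    (Q : Matrix (Fin nx) (Fin nx) ℝ) (hQ : Q.PosDef) (r : ℝ) (hr : 0 < r)
    (A : Matrix (Fin nx) (Fin nx) ℝ) (b : Fin nx → ℝ)
    (hctrb : IsUnit (ctrbMat A b)) :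
    ∃ C : ℝ, 0 < C ∧ ∃ ρ : ℝ, ρ ∈ Set.Ioo (0:ℝ) 1 ∧
      ∀ (f c : Fin nx → ℝ) (N : ℤ) (hN : 2 ≤ N)
        (K : ℕ) (hK : 1 ≤ K) (Mk Nk : ℕ → ℤ)
        (hM1 : Mk 1 = 1) (hNK : Nk K = N)
        (hblock : ∀ k, 1 ≤ k → k ≤ K → Mk k ≤ Nk k)
        (hconsec : ∀ k, 1 ≤ k → k ≤ K - 1 → Mk (k+1) = Nk k + 1)
        (ω : ℕ) (hω : 1 ≤ ω)
        (xs1 lsN : Fin nx → ℝ)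
        (xs : ℤ → Fin nx → ℝ) (us : ℤ → ℝ) (lams : ℤ → Fin nx → ℝ)
        (href : LQKKT A Q b f c r 1 N xs1 lsN xs us lams)
        (x l : ℕ → ℤ → Fin nx → ℝ)
        (hx0 : x 0 1 = xs1) (hl0 : l 0 N = lsN)
        (hiter : ∀ (t : ℕ) (k : ℕ), 1 ≤ k → k ≤ K →
          ∃ (xh : ℤ → Fin nx → ℝ) (uh : ℤ → ℝ) (lh : ℤ → Fin nx → ℝ),
            LQKKT A Q b f c r (max (Mk k - ω) 1) (min (Nk k + ω) N)
              (x t (max (Mk k - ω) 1)) (l t (min (Nk k + ω) N)) xh uh lh ∧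
            ∀ i : ℤ, Mk k ≤ i → i ≤ Nk k →
              x (t+1) i = xh i ∧ l (t+1) i = lh i),
        (∀ t : ℕ, ∀ i : ℤ, 1 ≤ i → i ≤ N →
          max ‖x t i - xs i‖ ‖l t i - lams i‖ ≤
            (2 * C * ρ ^ ω) ^ t *
              (Finset.Icc (1:ℤ) N).sup' (Finset.nonempty_Icc.mpr (by omega))
                (fun j => max ‖x 0 j - xs j‖ ‖l 0 j - lams j‖)) ∧
        (2 * C * ρ ^ ω < 1 → ∀ i : ℤ, 1 ≤ i → i ≤ N →
          Tendsto (fun t => max ‖x t i - xs i‖ ‖l t i - lams i‖) atTop (nhds 0)) := by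
  obtain ⟨C, hC, ρ, hρ, hρ1, hdecay⟩ :=
    IsHomKKT.exists_exponential_decay (A := A) (b := b) hnx hQ hr hctrb
  refine ⟨C, hC, ρ, ⟨hρ, hρ1⟩, ?_⟩
  intro f c N hN K hK Mk Nk hM1 hNK hblock hconsec ω hω xs1 lsN xs us lams href x l hx0 hl0 hiter
  set E := (Finset.Icc (1:ℤ) N).sup' (Finset.nonempty_Icc.mpr (by omega))
    (fun j => max ‖x 0 j - xs j‖ ‖l 0 j - lams j‖) with hE
  have hE0 : 0 ≤ E := (norm_nonneg (x 0 1 - xs 1)).trans <| (le_max_left _ _).trans <|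
    Finset.le_sup' (fun j => max ‖x 0 j - xs j‖ ‖l 0 j - lams j‖)
      (Finset.mem_Icc.mpr ⟨le_rfl, by omega⟩)
  have hxt : ∀ t, x t 1 = xs1 := by
    intro t
    induction t with
    | zero => exact hx0
    | succ t ih =>
      obtain ⟨xh, uh, lh, ⟨h1, -⟩, h2⟩ := hiter t 1 le_rfl hK
      rw [(h2 1 hM1.le (hM1 ▸ hblock 1 le_rfl hK)).1, ← ih]
      rwa [max_eq_right (by omega)] at h1
  have hlt : ∀ t, l t N = lsN := by
    intro t
    induction t with
    | zero => exact hl0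
    | succ t ih =>
      obtain ⟨xh, uh, lh, ⟨-, h1, -⟩, h2⟩ := hiter t K hK le_rfl
      rw [(h2 N (hNK ▸ hblock K hK le_rfl) hNK.ge).2, ← ih]
      rwa [min_eq_right (by omega)] at h1
  have hbound : ∀ t : ℕ, ∀ i : ℤ, 1 ≤ i → i ≤ N →
      max ‖x t i - xs i‖ ‖l t i - lams i‖ ≤ (2 * C * ρ ^ ω) ^ t * E := by
    intro t
    induction t with
    | zero =>
      intro i hi hi'
      rw [pow_zero, one_mul]
      exact Finset.le_sup' (fun j => max ‖x 0 j - xs j‖ ‖l 0 j - lams j‖)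
        (Finset.mem_Icc.mpr ⟨hi, hi'⟩)
    | succ t ih =>
      intro i hi hi'
      obtain ⟨k, hk, hkK, hMi, hiN⟩ := exists_mem_block hK hconsec (hM1 ▸ hi) (hNK ▸ hi')
      obtain ⟨xh, uh, lh, hkkt, heq⟩ := hiter t k hk hkK
      obtain ⟨hxi, hli⟩ := heq i hMi hiN
      set M' := max (Mk k - ω) 1 with hM'
      set N' := min (Nk k + ω) N with hN'
      obtain ⟨T, hT⟩ := Int.eq_ofNat_of_zero_le (show 0 ≤ N' - M' by omega)
      obtain ⟨p, hp⟩ := Int.eq_ofNat_of_zero_le (show 0 ≤ i - M' by omega)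
      have hMT : M' + T = N' := by omega
      have hMp : M' + p = i := by omega
      have hε : 0 ≤ (2 * C * ρ ^ ω) ^ t * E := by positivity
      have key := hdecay T _ _ _ (hkkt.isHomKKT_sub href (by omega) (by omega) hMT)
        ((2 * C * ρ ^ ω) ^ t * E) ω p (by omega) (by omega) hε
      simp only [Nat.cast_zero, add_zero, hMT, hMp, hkkt.1, hkkt.2.1, ← hxi, ← hli] at key
      obtain ⟨h1, h2⟩ := key ((le_max_left _ _).trans (ih M' (by omega) (by omega)))
        ((le_max_right _ _).trans (ih N' (by omega) (by omega)))
        (by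
          rcases le_total (Mk k - ω) 1 with h | h
          · left
            rw [hM', max_eq_right h, hxt, href.1, sub_self]
          · right
            omega)
        (by
          rcases le_total N (Nk k + ω) with h | h
          · left
            rw [hN', min_eq_right h, hlt, href.2.1, sub_self]
          · right
            omega)
      refine (max_le h1 h2).trans ?_
      rw [pow_succ', mul_assoc (2 * C * ρ ^ ω)]
      gcongr
      linarith
  refine ⟨hbound, fun hlt1 i hi hi' => ?_⟩
  refine squeeze_zero (fun t => le_max_of_le_left (norm_nonneg _)) (fun t => hbound t i hi hi') ?_
  simpa using (tendsto_pow_atTop_nhds_zero_of_lt_one (by positivity) hlt1).mul_const E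
end
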